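/- For every atom a and every memorising U-nand basic form P: EqMSCLℓN^U ⊢ a ⊼ P = a ⊼ T_a^U(P), EqMSCLℓN^U ⊢ a ⊼ (P ⊼ T) = a ⊼ (T_a^U(P) ⊼ T), EqMSCLℓN^U ⊢ (a ⊼ T) ⊼ P = (a ⊼ T) ⊼ F_a^U(P), and EqMSCLℓN^U ⊢ (a ⊼ T) ⊼ (P ⊼ T) = (a ⊼ T) ⊼ (F_a^U(P) ⊼ T). -/

import Mathlib

/-- Closed terms built from T, F, U, atoms, and the left-sequential NAND ⊼. -/
inductive NC (A : Type) : Type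
  | T : NC A
  | F : NC A
  | U : NC A
  | at_ : A → NC A
  | nand : NC A → NC A → NC A

/-- EqMSCLℓN^U-derivability on closed terms: the smallest congruence for ⊼
containing all closed instances of (N1), (N2), (N3) and (NU). -/
inductive NDeriv {A : Type} : NC A → NC A → Prop
  | refl (p : NC A) : NDeriv p p
  | symm {p q : NC A} : NDeriv p q → NDeriv q p
  | trans {p q r : NC A} : NDeriv p q → NDeriv q r → NDeriv p r
  | congr_nand {p p' q q' : NC A} : NDeriv p p' → NDeriv q q' →
      NDeriv (NC.nand p q) (NC.nand p' q')
  | ax_n1 : NDeriv NC.F (NC.nand NC.T NC.T)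
  | ax_n2 (x y : NC A) :
      NDeriv (NC.nand (NC.nand NC.T x) (NC.nand x y)) x
  | ax_n3 (x y z : NC A) :
      NDeriv (NC.nand (NC.nand x (NC.nand y NC.T)) z)
             (NC.nand
               (NC.nand (NC.nand x (NC.nand (NC.nand y z) NC.T))
                        (NC.nand (NC.nand x NC.T) z))
               NC.T)
  | ax_nu (x : NC A) : NDeriv (NC.nand NC.U x) NC.U

/-- Occurrence of an atom in a closed term. -/
def occurs {A : Type} (a : A) : NC A → Prop
  | NC.T => False
  | NC.F => False
  | NC.U => False
  | NC.at_ b => b = a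
  | NC.nand p q => occurs a p ∨ occurs a q

/-- Memorising U-nand basic forms (mUNBFs):
T, F, U are mUNBFs, and (at(a) ⊼ P) ⊼ ((at(a) ⊼ T) ⊼ Q) is a mUNBF whenever
P and Q are mUNBFs not containing the atom a. -/
inductive IsMUNBF {A : Type} : NC A → Prop
  | T : IsMUNBF NC.T
  | F : IsMUNBF NC.F
  | U : IsMUNBF NC.U
  | node (a : A) {p q : NC A} : IsMUNBF p → IsMUNBF q →
      ¬ occurs a p → ¬ occurs a q →
      IsMUNBF (NC.nand (NC.nand (NC.at_ a) p)
                       (NC.nand (NC.nand (NC.at_ a) NC.T) q))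

/-- The function T_a^U (defined on mUNBFs; extended trivially elsewhere). -/
def Ta {A : Type} [DecidableEq A] (a : A) : NC A → NC A
  | NC.nand (NC.nand (NC.at_ b) p1) (NC.nand (NC.nand (NC.at_ c) NC.T) p2) =>
      if b = c then
        (if b = a then p1
         else NC.nand (NC.nand (NC.at_ b) (Ta a p1))
                      (NC.nand (NC.nand (NC.at_ c) NC.T) (Ta a p2)))
      else NC.nand (NC.nand (NC.at_ b) p1) (NC.nand (NC.nand (NC.at_ c) NC.T) p2)
  | t => t

/-- The function F_a^U (defined on mUNBFs; extended trivially elsewhere). -/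
def Fa {A : Type} [DecidableEq A] (a : A) : NC A → NC A
  | NC.nand (NC.nand (NC.at_ b) p1) (NC.nand (NC.nand (NC.at_ c) NC.T) p2) =>
      if b = c then
        (if b = a then p2
         else NC.nand (NC.nand (NC.at_ b) (Fa a p1))
                      (NC.nand (NC.nand (NC.at_ c) NC.T) (Fa a p2)))
      else NC.nand (NC.nand (NC.at_ b) p1) (NC.nand (NC.nand (NC.at_ c) NC.T) p2)
  | t => t

/-- Algebras for the memorising left-sequential NAND: models of (N2) and (N3). -/
class MemNand (Q : Type*) where
  nand : Q → Q → Q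
  tt : Q
  nand_absorb (x y : Q) : nand (nand tt x) (nand x y) = x
  nand_mem (x y z : Q) : nand (nand x (nand y tt)) z =
    nand (nand (nand x (nand (nand y z) tt)) (nand (nand x tt) z)) tt

namespace MemNand
local infixl:70 "⊼" => nand
local notation:max x "†" => nand x tt
variable {Q : Type*} [MemNand Q]

theorem ttt_nand (x : Q) : (tt ⊼ (tt ⊼ x)) ⊼ x = tt ⊼ x := by
  simpa only [nand_absorb x tt] using nand_absorb (tt ⊼ x) x†

theorem ff_nand_tt (x : Q) : (tt : Q)† ⊼ (tt ⊼ x) = tt := nand_absorb tt x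

theorem tt_neg_nand (x y : Q) : (tt ⊼ x†) ⊼ (tt ⊼ y) = (tt ⊼ (x ⊼ (tt ⊼ y))†)†† := by
  rw [nand_mem, ff_nand_tt]

theorem tt_ff_neg : (tt ⊼ (tt : Q)†)† = tt† := ttt_nand tt

theorem tt_ff_nand_ff : (tt ⊼ (tt : Q)†) ⊼ tt† = tt†† := by
  rw [tt_neg_nand, tt_ff_neg, tt_ff_neg]

theorem ff_neg : (tt : Q)†† = tt := by
  have h₁ : (tt : Q)†† = (tt ⊼ tt†††)†† := by
    simpa only [tt_ff_neg, tt_ff_nand_ff] using tt_neg_nand (tt ⊼ (tt : Q)†) tt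
  have h₂ : (tt : Q)†††† = tt := by
    simpa only [tt_ff_neg, tt_ff_nand_ff, nand_absorb, ff_nand_tt] using
      (nand_mem (tt ⊼ (tt : Q)†) tt† tt†).symm
  have h₃ : (tt ⊼ (tt : Q)†††)† = tt††† := by
    simpa only [h₂] using nand_absorb (tt : Q)††† tt
  rw [h₁, h₃, h₂]

theorem tt_ff : tt ⊼ (tt : Q)† = tt := by
  have h₁ : (tt ⊼ (tt ⊼ (tt : Q)†))† = tt ⊼ tt† := by
    simpa only [tt_ff_nand_ff, ff_neg] using nand_absorb (tt ⊼ (tt : Q)†) tt†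
  have h₂ : (tt ⊼ (tt : Q)†) ⊼ (tt ⊼ tt†) = tt† := by
    rw [tt_neg_nand, h₁, h₁, tt_ff_neg]
  have h₃ : tt ⊼ (tt ⊼ (tt : Q)†) = tt† := by
    simpa only [h₂, tt_ff_neg, tt_ff_nand_ff, ff_neg, ff_nand_tt] using
      nand_mem (tt ⊼ (tt : Q)†) (tt ⊼ (tt : Q)†) (tt ⊼ (tt : Q)†)
  rw [← h₁, h₃, ff_neg]

theorem ff_nand_absorb (x y : Q) : (tt : Q)† ⊼ ((tt† ⊼ x) ⊼ y) = tt† ⊼ x := by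
  have h : tt ⊼ ((tt : Q)† ⊼ x) = tt† := by
    simpa only [tt_ff] using nand_absorb (tt : Q)† x
  simpa only [h] using nand_absorb ((tt : Q)† ⊼ x) y

theorem tt_neg_neg (x : Q) : (tt ⊼ x††)†† = (tt ⊼ x†)† := by
  rw [nand_mem tt x tt, ff_neg]

theorem ff_nand_tt_nand (x : Q) : (((tt : Q)† ⊼ x) ⊼ (tt ⊼ x))† = tt ⊼ x := by
  simpa only [ff_neg, ff_nand_absorb] using (nand_mem (tt : Q)† tt† x).symm

theorem ttt_tt_neg (x : Q) : (tt ⊼ (tt ⊼ (tt ⊼ x)))† = tt ⊼ (tt ⊼ x) := by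
  simpa only [ff_nand_tt] using ff_nand_tt_nand (tt ⊼ x)

theorem ttt_neg (x : Q) : (tt ⊼ (tt ⊼ x))† = tt ⊼ (tt ⊼ (tt ⊼ x)) := by
  have h := tt_neg_nand tt (tt ⊼ x)
  rwa [tt_ff, ttt_tt_neg, ttt_tt_neg, eq_comm] at h

theorem tt_nand_neg_aux (x : Q) : (tt ⊼ (tt ⊼ (tt ⊼ x)†)†)† = tt ⊼ (tt ⊼ x) := by
  have h := tt_neg_neg (((tt : Q)† ⊼ x) ⊼ (tt ⊼ x))
  rw [ff_nand_tt_nand, ttt_neg] at h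
  rw [← tt_neg_neg, h, ← ttt_neg, ttt_tt_neg, ttt_neg, ttt_tt_neg]

theorem tt_tt_nand_neg (x : Q) : tt ⊼ (tt ⊼ x)† = tt ⊼ x := by
  have h : tt ⊼ (tt ⊼ (tt ⊼ x)†) = tt ⊼ (tt ⊼ x) := by
    rw [← tt_nand_neg_aux, tt_nand_neg_aux x, ttt_tt_neg]
  rw [← ttt_nand, h, nand_absorb]

theorem tt_nand_neg (x : Q) : (tt ⊼ x)† = tt ⊼ (tt ⊼ x) := by
  simpa only [tt_tt_nand_neg] using tt_nand_neg_aux x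

theorem tt_tt_tt (x : Q) : tt ⊼ (tt ⊼ (tt ⊼ x)) = tt ⊼ x := by
  simpa only [tt_nand_neg] using tt_tt_nand_neg x

theorem nand_tt_nand (x y : Q) : (x ⊼ (tt ⊼ y)) ⊼ y = (x ⊼ tt†) ⊼ y := by
  have h : (tt ⊼ (tt ⊼ y))† = tt ⊼ y := by rw [tt_nand_neg, tt_tt_tt]
  rw [← h, nand_mem, ttt_nand, ← nand_mem]

theorem tt_neg_neg_eq (x : Q) : tt ⊼ x†† = x† := by
  have h : tt ⊼ (tt ⊼ x††) = tt ⊼ x† := by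
    have h := tt_neg_neg x
    rw [tt_nand_neg x††, tt_nand_neg x†, tt_nand_neg, tt_tt_tt] at h
    rw [h, tt_tt_tt]
  have h₁ := nand_tt_nand tt x††
  rwa [h, nand_absorb, tt_ff, eq_comm] at h₁

theorem ff_nand (x : Q) : (tt : Q)† ⊼ x = tt := by
  rw [← ff_nand_absorb x tt, ← tt_neg_neg_eq (tt† ⊼ x), ff_nand_tt]

theorem tt_neg (x : Q) : tt ⊼ x† = x := by
  have h (x y : Q) : (tt ⊼ x†) ⊼ y = tt ⊼ (x ⊼ y)† := by
    rw [nand_mem, ff_nand, tt_nand_neg, tt_nand_neg, tt_tt_tt]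
  conv_lhs => rw [← nand_absorb x tt, ← h, tt_nand_neg, tt_tt_tt]
  exact nand_absorb x tt

theorem neg_neg (x : Q) : x†† = x := by
  rw [← tt_neg_neg_eq x, tt_nand_neg, tt_neg_neg_eq, tt_neg]

theorem tt_nand (x : Q) : tt ⊼ x = x† := by
  conv_lhs => rw [← tt_neg x, ← tt_nand_neg, tt_neg]

theorem neg_nand_nand (x y : Q) : x† ⊼ (x ⊼ y) = x := by
  simpa only [tt_nand] using nand_absorb x y

theorem nand_neg_nand (x y : Q) : x ⊼ (x† ⊼ y) = x† := by
  simpa only [neg_neg] using neg_nand_nand x† y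

theorem nand_self (x : Q) : x ⊼ x = x† := by
  simpa only [neg_nand_nand] using nand_neg_nand x (x ⊼ x)

theorem nand_nand_self (x y : Q) : (x ⊼ y) ⊼ x = x ⊼ y† := by
  have h := nand_mem x y tt
  simp only [neg_neg] at h
  rw [← neg_neg (x ⊼ y†), h, neg_neg]

theorem nand_neg_nand_nand (x y z : Q) : (x ⊼ y†) ⊼ (x ⊼ z) = (x ⊼ (y ⊼ (x ⊼ z)))† := by
  rw [nand_mem, neg_nand_nand, nand_nand_self, neg_neg]

theorem neg_nand_self (x : Q) : x† ⊼ x = x ⊼ tt† := nand_nand_self x tt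

theorem nand_neg_self (x : Q) : x ⊼ x† = x ⊼ tt† := by
  rw [← nand_nand_self, nand_self, neg_nand_self]

theorem neg_nand_ff (x : Q) : x† ⊼ tt† = x ⊼ tt† := by
  rw [← nand_neg_self x†, neg_neg, neg_nand_self]

theorem nand_ff_nand_nand (x y : Q) : ((x ⊼ tt†) ⊼ (x† ⊼ y))† = x† ⊼ y := by
  have h := nand_mem x tt† y
  rwa [ff_neg, ff_nand, eq_comm] at h

theorem nand_nand_neg (x y : Q) : x ⊼ (x ⊼ y)† = x ⊼ y := by
  have h := nand_neg_nand_nand x tt y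
  have h₁ := nand_ff_nand_nand x† y
  rw [neg_neg, neg_nand_ff, h, neg_neg, tt_nand] at h₁
  exact h₁

theorem nand_nand_eq (x y : Q) : x ⊼ (x ⊼ y) = x ⊼ y† := by
  rw [← neg_neg (x ⊼ y), ← nand_nand_self, nand_nand_neg, nand_nand_self]

theorem nand_neg_nand_nand_nand (x y z : Q) :
    ((x ⊼ (y ⊼ z†)†) ⊼ (x† ⊼ y))† = (x ⊼ (y ⊼ z)†) ⊼ y := by
  rw [← nand_nand_self y z, ← nand_mem]

theorem nand_nand_nand_ff (x y : Q) : x ⊼ (y ⊼ (x ⊼ tt†)) = x ⊼ y† := by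
  rw [← neg_neg (x ⊼ (y ⊼ _)), ← nand_neg_nand_nand, ← nand_nand_neg x y†, ← neg_nand_self,
    nand_neg_nand_nand_nand, nand_nand_neg, nand_nand_self, nand_nand_neg]

theorem nand_nand_self_nand_ff (x y : Q) : x ⊼ ((y ⊼ x) ⊼ (x ⊼ tt†)) = x ⊼ y := by
  rw [← neg_neg (x ⊼ (_ ⊼ _)), ← nand_neg_nand_nand, ← neg_nand_self, ← nand_mem,
    nand_nand_self, neg_neg]

theorem nand_nand_self_neg (x y : Q) : x ⊼ (y ⊼ x)† = x ⊼ y := by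
  rw [← nand_nand_nand_ff, nand_nand_self_nand_ff]

theorem nand_neg_nand_nand_absorb (x y z : Q) : x ⊼ ((x† ⊼ y) ⊼ (x ⊼ z)) = x ⊼ z := by
  rw [← neg_neg (x ⊼ (_ ⊼ _)), ← nand_neg_nand_nand, ← nand_nand_eq, nand_neg_nand,
    nand_neg_nand_nand, neg_neg, nand_nand_eq, nand_nand_neg]

theorem nand_ff_nand (x y : Q) : ((x ⊼ y) ⊼ (x† ⊼ y))† = (x ⊼ tt†) ⊼ y := by
  rw [nand_mem, tt_nand, neg_neg]

theorem nand_nand_neg_right (x y : Q) : (x ⊼ y) ⊼ y† = (x ⊼ tt†) ⊼ y† := by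
  have h (y : Q) : (x ⊼ y†) ⊼ y = (x ⊼ tt†) ⊼ y := by
    rw [nand_mem, nand_self, neg_neg, nand_ff_nand]
  simpa only [neg_neg] using h y†

theorem nand_nand_nand_neg (x y : Q) : x ⊼ ((x ⊼ y) ⊼ y†) = x ⊼ y := by
  have h (y : Q) : x ⊼ ((x ⊼ tt†) ⊼ y)† = x ⊼ y := by
    have h := nand_ff_nand x† y
    rw [neg_neg, neg_nand_ff] at h
    rw [← h, neg_neg, nand_neg_nand_nand_absorb]
  rw [nand_nand_neg_right, ← neg_neg ((x ⊼ tt†) ⊼ y†), ← nand_nand_eq, h, nand_nand_eq, neg_neg]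

theorem nand_nand_nand_neg_nand (x y z : Q) : x ⊼ ((x ⊼ y) ⊼ (x† ⊼ z)) = x ⊼ y := by
  have h := nand_nand_nand_neg x ((x† ⊼ z) ⊼ (x ⊼ y))
  rwa [nand_neg_nand_nand_absorb, nand_nand_self_neg] at h

theorem nand_neg_nand_neg (x y z : Q) : x ⊼ ((x† ⊼ y) ⊼ z)† = x ⊼ z := by
  have h := nand_mem x† y† z
  rw [neg_neg, neg_neg] at h
  rw [h, neg_neg, nand_neg_nand_nand_absorb]

theorem nand_nand_neg_nand_neg (x y z : Q) : x ⊼ (y ⊼ (x† ⊼ z))† = x ⊼ y := by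
  rw [← nand_neg_nand_neg x z, nand_nand_self_neg, nand_neg_nand_neg]

theorem nand_nand_neg_nand (x y z : Q) : x ⊼ ((x ⊼ y†) ⊼ z) = x ⊼ (y ⊼ z) := by
  rw [nand_mem, nand_nand_neg_nand_neg, nand_nand_eq, neg_neg]

theorem nand_nand_nand (x y z : Q) : x ⊼ ((x ⊼ y) ⊼ z) = x ⊼ (y† ⊼ z) := by
  simpa only [neg_neg] using nand_nand_neg_nand x y† z

theorem nand_nand_self_neg_nand (x y z : Q) : x ⊼ ((y ⊼ x)† ⊼ z) = x ⊼ (y ⊼ z) := by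
  have h : x ⊼ (y ⊼ x) = x ⊼ y† := by
    rw [← neg_neg (y ⊼ x), ← nand_nand_eq, nand_nand_self_neg, nand_nand_eq]
  rw [← nand_nand_nand, h, nand_nand_neg_nand]

theorem nand_nand_neg_nand_left (x y z : Q) : x ⊼ ((x ⊼ y)† ⊼ z) = x ⊼ (y ⊼ z) := by
  rw [← nand_nand_nand, nand_nand_eq, nand_nand_neg_nand]

theorem nand_nand_nand_right (x y z : Q) : x ⊼ (y ⊼ (x ⊼ z)) = x ⊼ (y ⊼ z†) := by
  rw [← nand_nand_self_neg_nand y x z, ← nand_nand_neg_nand_left, nand_nand_eq,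
    nand_nand_neg_nand_left]

/-- Under `x†`, a conditional on `x` reduces to its second branch. -/
theorem neg_nand_nand_nand_neg_nand (x y z : Q) : x† ⊼ ((x ⊼ y) ⊼ (x† ⊼ z)) = x† ⊼ z := by
  have h (w : Q) : x† ⊼ ((x ⊼ y) ⊼ w) = x† ⊼ w† := by
    have h := nand_neg_nand_neg x† y w
    rw [neg_neg] at h
    rw [← neg_neg ((x ⊼ y) ⊼ w), ← nand_nand_eq, h, nand_nand_eq]
  rw [h, nand_nand_neg]

theorem nand_nand_congr_right {x y y₁ : Q} (b : Q) (h : x ⊼ y = x ⊼ y₁) :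
    x ⊼ (b ⊼ y) = x ⊼ (b ⊼ y₁) := by
  rw [← neg_neg y, ← neg_neg y₁, ← nand_nand_nand_right, ← nand_nand_eq, h, nand_nand_eq,
    nand_nand_nand_right]

theorem nand_neg_congr {x y y₁ : Q} (h : x ⊼ y = x ⊼ y₁) : x ⊼ y† = x ⊼ y₁† := by
  rw [← nand_nand_eq, h, nand_nand_eq]

theorem nand_nand_congr_left {x y y₁ : Q} (b : Q) (h : x ⊼ y = x ⊼ y₁) :
    x ⊼ (y ⊼ b) = x ⊼ (y₁ ⊼ b) := by
  rw [← neg_neg y, ← neg_neg y₁, ← nand_nand_nand, nand_neg_congr h, nand_nand_nand]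

theorem nand_cond_congr {x y y₁ z z₁ : Q} (b : Q) (hy : x ⊼ y = x ⊼ y₁) (hz : x ⊼ z = x ⊼ z₁) :
    x ⊼ ((b ⊼ y) ⊼ (b† ⊼ z)) = x ⊼ ((b ⊼ y₁) ⊼ (b† ⊼ z₁)) := by
  rw [nand_nand_congr_left _ (nand_nand_congr_right b hy),
    nand_nand_congr_right _ (nand_nand_congr_right b† hz)]

end MemNand

/-- Derivability as a setoid on closed terms. -/
def NDeriv.setoid (A : Type) : Setoid (NC A) where
  r := NDeriv
  iseqv := ⟨NDeriv.refl, NDeriv.symm, NDeriv.trans⟩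

/-- Closed terms modulo derivability. -/
def NCQuot (A : Type) : Type := Quotient (NDeriv.setoid A)

namespace NCQuot
variable {A : Type}

/-- The class of a closed term. -/
def mk (p : NC A) : NCQuot A := Quotient.mk (NDeriv.setoid A) p

theorem mk_eq_mk {p q : NC A} : mk p = mk q ↔ NDeriv p q :=
  ⟨fun h => Quotient.exact h, fun h => Quotient.sound h⟩

instance : MemNand (NCQuot A) where
  nand := Quotient.map₂ NC.nand fun _ _ h _ _ h₁ => NDeriv.congr_nand h h₁
  tt := mk NC.T
  nand_absorb := by
    rintro ⟨x⟩ ⟨y⟩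
    exact Quotient.sound (NDeriv.ax_n2 x y)
  nand_mem := by
    rintro ⟨x⟩ ⟨y⟩ ⟨z⟩
    exact Quotient.sound (NDeriv.ax_n3 x y z)

theorem mk_nand (p q : NC A) : mk (NC.nand p q) = MemNand.nand (mk p) (mk q) := rfl

theorem mk_T : mk (NC.T : NC A) = MemNand.tt := rfl

theorem nand_mk_Ta_Fa [DecidableEq A] (a : A) {P : NC A} (h : IsMUNBF P) :
    mk (NC.nand (NC.at_ a) P) = mk (NC.nand (NC.at_ a) (Ta a P)) ∧
    mk (NC.nand (NC.nand (NC.at_ a) NC.T) P) =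
      mk (NC.nand (NC.nand (NC.at_ a) NC.T) (Fa a P)) := by
  induction h with
  | T => exact ⟨rfl, rfl⟩
  | F => exact ⟨rfl, rfl⟩
  | U => exact ⟨rfl, rfl⟩
  | node b _ _ _ _ ihp ihq =>
    obtain rfl | hb := eq_or_ne b a
    · simp only [Ta, Fa, if_true, mk_nand, mk_T]
      exact ⟨MemNand.nand_nand_nand_neg_nand _ _ _, MemNand.neg_nand_nand_nand_neg_nand _ _ _⟩
    · simp only [Ta, Fa, if_true, if_neg hb, mk_nand, mk_T] at ihp ihq ⊢
      exact ⟨MemNand.nand_cond_congr _ ihp.1 ihq.1, MemNand.nand_cond_congr _ ihp.2 ihq.2⟩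

end NCQuot

/-- For every atom a and mUNBF P:
a ⊼ P = a ⊼ T_a^U(P), a ⊼ P' = a ⊼ T_a^U(P)', a' ⊼ P = a' ⊼ F_a^U(P), a' ⊼ P' = a' ⊼ F_a^U(P)'
are derivable in EqMSCLℓN^U (where x' abbreviates x ⊼ T). -/
theorem munbf_reduction {A : Type} [DecidableEq A] (a : A) (P : NC A) (h : IsMUNBF P) :
    NDeriv (NC.nand (NC.at_ a) P) (NC.nand (NC.at_ a) (Ta a P)) ∧
    NDeriv (NC.nand (NC.at_ a) (NC.nand P NC.T))
           (NC.nand (NC.at_ a) (NC.nand (Ta a P) NC.T)) ∧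
    NDeriv (NC.nand (NC.nand (NC.at_ a) NC.T) P)
           (NC.nand (NC.nand (NC.at_ a) NC.T) (Fa a P)) ∧
    NDeriv (NC.nand (NC.nand (NC.at_ a) NC.T) (NC.nand P NC.T))
           (NC.nand (NC.nand (NC.at_ a) NC.T) (NC.nand (Fa a P) NC.T)) := by
  obtain ⟨hT, hF⟩ := NCQuot.nand_mk_Ta_Fa a h
  simp only [← NCQuot.mk_eq_mk, NCQuot.mk_nand, NCQuot.mk_T] at hT hF ⊢
  exact ⟨hT, MemNand.nand_neg_congr hT, hF, MemNand.nand_neg_congr hF⟩
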